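/- arXiv:2509.04774 — 2 statements merged into one kernel-verified Lean document; each statement's English description precedes it below -/
import Mathlib

section
/- Let I be a monomial ideal in R = K[x_1,…,x_n] and let 𝔪 = (x_1,…,x_n). For each j ∈ [n], let I[x_j] = (I : x_j^∞) be the saturation of I with respect to x_j. Then for all t ≥ 1, Ass(I^t) ∖ {𝔪} = ⋃_{j=1}^n Ass(I[x_j]^t). -/
open MvPolynomial

noncomputable section

variable {n : ℕ} {K : Type*} [Field K]

/-- `I` is a monomial ideal: it is generated by (monic) monomials. -/
def IsMonomialIdeal (I : Ideal (MvPolynomial (Fin n) K)) : Prop :=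
  ∃ S : Set (Fin n →₀ ℕ), I = Ideal.span ((fun d => (monomial d (1 : K) : MvPolynomial (Fin n) K)) '' S)

/-- The maximal graded ideal `𝔪 = (x_1, …, x_n)`. -/
def maxGradedIdeal (n : ℕ) (K : Type*) [Field K] : Ideal (MvPolynomial (Fin n) K) :=
  Ideal.span (Set.range (X : Fin n → MvPolynomial (Fin n) K))

/-- `I[x_j] = (I : x_j^∞)`, the saturation of `I` with respect to the variable `x_j`. -/
def satVar (I : Ideal (MvPolynomial (Fin n) K)) (j : Fin n) : Ideal (MvPolynomial (Fin n) K) :=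
  ⨆ k : ℕ, I.colon (Ideal.span {(X j : MvPolynomial (Fin n) K) ^ k})

theorem Ideal.mem_associatedPrimes_quotient_iff {R : Type*} [CommRing R] [IsNoetherianRing R]
    {A P : Ideal R} :
    P ∈ associatedPrimes R (R ⧸ A) ↔ P.IsPrime ∧ ∃ f : R, ∀ g, g ∈ P ↔ g * f ∈ A := by
  have key (f g : R) : g ∈ (⊥ : Submodule R (R ⧸ A)).colon {Ideal.Quotient.mk A f} ↔
      g * f ∈ A := by
    rw [Submodule.mem_colon_singleton, Submodule.mem_bot, ← Ideal.Quotient.eq_zero_iff_mem,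
      map_mul, Algebra.smul_def, Ideal.Quotient.algebraMap_eq]
  rw [AssociatedPrimes.mem_iff, isAssociatedPrime_iff]
  refine and_congr_right fun _ ↦ ⟨?_, ?_⟩
  · rintro ⟨x, hx⟩
    obtain ⟨f, rfl⟩ := Ideal.Quotient.mk_surjective x
    exact ⟨f, fun g ↦ by rw [hx, key]⟩
  · rintro ⟨f, hf⟩
    exact ⟨Ideal.Quotient.mk A f, by ext g; rw [hf, key]⟩

/-- If `A ≤ B` and `y B ⊆ A`, then `A` and `B` have the same associated primes avoiding `y`. -/
theorem Ideal.mem_associatedPrimes_quotient_iff_of_notMem {R : Type*} [CommRing R]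
    [IsNoetherianRing R] {A B P : Ideal R} {y : R} (hAB : A ≤ B) (hBA : ∀ b ∈ B, y * b ∈ A)
    (hy : y ∉ P) :
    P ∈ associatedPrimes R (R ⧸ A) ↔ P ∈ associatedPrimes R (R ⧸ B) := by
  rw [mem_associatedPrimes_quotient_iff, mem_associatedPrimes_quotient_iff]
  refine and_congr_right fun hP ↦ ⟨?_, ?_⟩
  · rintro ⟨f, hf⟩
    refine ⟨f, fun g ↦ ⟨fun hg ↦ hAB ((hf g).1 hg), fun hg ↦ ?_⟩⟩
    refine (hP.mem_or_mem ((hf (y * g)).2 ?_)).resolve_left hy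
    simpa only [mul_assoc] using hBA _ hg
  · rintro ⟨f, hf⟩
    refine ⟨y * f, fun g ↦ ⟨fun hg ↦ ?_, fun hg ↦ ?_⟩⟩
    · simpa only [mul_left_comm] using hBA _ ((hf g).1 hg)
    · refine (hP.mem_or_mem ((hf (y * g)).2 ?_)).resolve_left hy
      simpa only [mul_assoc, mul_left_comm] using hAB hg

theorem mem_satVar {I : Ideal (MvPolynomial (Fin n) K)} {j : Fin n}
    {f : MvPolynomial (Fin n) K} : f ∈ satVar I j ↔ ∃ k : ℕ, f * X j ^ k ∈ I := by
  have hmono : Monotone fun k : ℕ ↦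
      I.colon (Ideal.span {(X j : MvPolynomial (Fin n) K) ^ k}) := by
    intro a b hab g hg
    rw [Ideal.mem_colon_span_singleton] at hg ⊢
    rw [← Nat.add_sub_cancel' hab, pow_add, ← mul_assoc]
    exact I.mul_mem_right _ hg
  rw [satVar, Submodule.mem_iSup_of_directed _ hmono.directed_le]
  simp only [Ideal.mem_colon_span_singleton]

theorem le_satVar (I : Ideal (MvPolynomial (Fin n) K)) (j : Fin n) : I ≤ satVar I j :=
  fun f hf ↦ mem_satVar.2 ⟨0, by simpa using hf⟩

theorem exists_span_X_pow_mul_satVar_le (I : Ideal (MvPolynomial (Fin n) K)) (j : Fin n) :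
    ∃ k : ℕ, Ideal.span {(X j : MvPolynomial (Fin n) K) ^ k} * satVar I j ≤ I := by
  obtain ⟨T, hT⟩ := IsNoetherian.noetherian (satVar I j)
  have hmem (f : T) : ∃ k : ℕ, (f : MvPolynomial (Fin n) K) * X j ^ k ∈ I :=
    mem_satVar.1 (hT ▸ Submodule.subset_span f.2)
  choose k hk using hmem
  refine ⟨∑ f, k f, ?_⟩
  rw [← hT, ← Ideal.span, Ideal.span_mul_span', Ideal.span_le]
  rintro _ ⟨a, rfl, f, hf, rfl⟩
  obtain ⟨c, hc⟩ := pow_dvd_pow (X j : MvPolynomial (Fin n) K)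
    (Finset.single_le_sum (f := k) (fun _ _ ↦ Nat.zero_le _) (Finset.mem_univ ⟨f, hf⟩))
  have := I.mul_mem_right c (hk ⟨f, hf⟩)
  simpa only [SetLike.mem_coe, hc, mul_comm, mul_left_comm, mul_assoc] using this

theorem add_single_mem_support_mul_X_pow {f : MvPolynomial (Fin n) K} {d : Fin n →₀ ℕ}
    (hd : d ∈ f.support) (j : Fin n) (k : ℕ) :
    d + Finsupp.single j k ∈ (f * X j ^ k).support := by
  rw [X_pow_eq_monomial, mem_support_iff, coeff_mul_monomial, mul_one]
  exact mem_support_iff.1 hd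

theorem satVar_span_monomial (S : Set (Fin n →₀ ℕ)) (j : Fin n) :
    satVar (Ideal.span ((fun d ↦ (monomial d (1 : K) : MvPolynomial (Fin n) K)) '' S)) j =
      Ideal.span ((fun d ↦ monomial d (1 : K)) '' (Finsupp.erase j '' S)) := by
  apply le_antisymm
  · intro f hf
    obtain ⟨k, hk⟩ := mem_satVar.1 hf
    rw [mem_ideal_span_monomial_image] at hk ⊢
    intro d hd
    obtain ⟨s, hs, hsd⟩ := hk _ (add_single_mem_support_mul_X_pow hd j k)
    refine ⟨_, ⟨s, hs, rfl⟩, fun i ↦ ?_⟩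
    by_cases hij : i = j
    · simp [hij]
    · simpa [hij, Finsupp.single_apply, Ne.symm hij] using hsd i
  · rw [Ideal.span_le]
    rintro _ ⟨_, ⟨s, hs, rfl⟩, rfl⟩
    refine mem_satVar.2 ⟨s j, Ideal.subset_span ⟨s, hs, ?_⟩⟩
    simp only [X_pow_eq_monomial, monomial_mul, mul_one, Finsupp.erase_add_single]

open scoped Pointwise in
theorem exists_pow_span_monomial_eq (S : Set (Fin n →₀ ℕ)) (j : Fin n) (hS : ∀ s ∈ S, s j = 0)
    (t : ℕ) : ∃ T : Set (Fin n →₀ ℕ), (∀ s ∈ T, s j = 0) ∧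
      Ideal.span ((fun d ↦ (monomial d (1 : K) : MvPolynomial (Fin n) K)) '' S) ^ t =
        Ideal.span ((fun d ↦ monomial d (1 : K)) '' T) := by
  induction t with
  | zero => exact ⟨{0}, by simp, by simp [Ideal.one_eq_top]⟩
  | succ t ih =>
    obtain ⟨T, hT, h⟩ := ih
    refine ⟨T + S, ?_, ?_⟩
    · rintro _ ⟨a, ha, b, hb, rfl⟩
      simp [hT a ha, hS b hb]
    · rw [pow_succ, h, Ideal.span_mul_span', ← Set.image2_mul, ← Set.image2_add,
        Set.image2_image_left, Set.image2_image_right, Set.image_image2]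
      simp only [monomial_mul, mul_one]

theorem mem_of_mul_X_mem_satVar_pow {I : Ideal (MvPolynomial (Fin n) K)}
    (hI : IsMonomialIdeal I) (j : Fin n) (t : ℕ) {f : MvPolynomial (Fin n) K}
    (hf : f * X j ∈ satVar I j ^ t) : f ∈ satVar I j ^ t := by
  obtain ⟨S, rfl⟩ := hI
  obtain ⟨T, hT, h⟩ := exists_pow_span_monomial_eq (K := K) (Finsupp.erase j '' S) j
    (by rintro _ ⟨s, -, rfl⟩; simp) t
  rw [satVar_span_monomial, h, mem_ideal_span_monomial_image] at hf ⊢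
  intro d hd
  obtain ⟨s, hs, hsd⟩ := hf _
    ((pow_one (X j : MvPolynomial (Fin n) K)) ▸ add_single_mem_support_mul_X_pow hd j 1)
  refine ⟨s, hs, fun i ↦ ?_⟩
  by_cases hij : i = j
  · simp [hij, hT s hs]
  · simpa [Finsupp.single_apply, Ne.symm hij] using hsd i

theorem X_notMem_of_mem_associatedPrimes_satVar_pow {I P : Ideal (MvPolynomial (Fin n) K)}
    (hI : IsMonomialIdeal I) {j : Fin n} {t : ℕ}
    (hP : P ∈ associatedPrimes _ (MvPolynomial (Fin n) K ⧸ satVar I j ^ t)) : X j ∉ P := by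
  obtain ⟨hprime, f, hf⟩ := Ideal.mem_associatedPrimes_quotient_iff.1 hP
  intro hX
  refine hprime.one_notMem ((hf 1).2 ?_)
  rw [one_mul]
  exact mem_of_mul_X_mem_satVar_pow hI j t (by simpa only [mul_comm] using (hf _).1 hX)

theorem mem_associatedPrimes_pow_iff_satVar_pow {I P : Ideal (MvPolynomial (Fin n) K)}
    {j : Fin n} (hP : P.IsPrime) (hj : X j ∉ P) (t : ℕ) :
    P ∈ associatedPrimes _ (MvPolynomial (Fin n) K ⧸ I ^ t) ↔
      P ∈ associatedPrimes _ (MvPolynomial (Fin n) K ⧸ satVar I j ^ t) := by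
  obtain ⟨k, hk⟩ := exists_span_X_pow_mul_satVar_le I j
  refine Ideal.mem_associatedPrimes_quotient_iff_of_notMem (y := (X j ^ k) ^ t)
    (Ideal.pow_right_mono (le_satVar I j) t) (fun b hb ↦ ?_)
    fun h ↦ hj (hP.mem_of_pow_mem _ (hP.mem_of_pow_mem _ h))
  have := Ideal.pow_right_mono hk t
  rw [mul_pow] at this
  exact this (Ideal.mul_mem_mul (Ideal.pow_mem_pow (Ideal.mem_span_singleton_self _) t) hb)

theorem maxGradedIdeal_isMaximal (n : ℕ) (K : Type*) [Field K] :
    (maxGradedIdeal n K).IsMaximal := by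
  have h : maxGradedIdeal n K = RingHom.ker (constantCoeff (σ := Fin n) (R := K)) := by
    ext f
    rw [maxGradedIdeal, ← Set.image_univ, mem_ideal_span_X_image, RingHom.mem_ker,
      constantCoeff_eq]
    constructor
    · intro h
      by_contra h0
      obtain ⟨i, -, hi⟩ := h 0 (mem_support_iff.2 h0)
      exact hi rfl
    · intro h d hd
      by_contra! hd0
      have : d = 0 := Finsupp.ext fun i ↦ hd0 i trivial
      exact mem_support_iff.1 hd (this ▸ h)
  rw [h]
  exact RingHom.ker_isMaximal_of_surjective _ fun c ↦ ⟨C c, constantCoeff_C _ c⟩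

theorem exists_X_notMem_of_ne_maxGradedIdeal {P : Ideal (MvPolynomial (Fin n) K)}
    (hP : P ≠ ⊤) (hne : P ≠ maxGradedIdeal n K) : ∃ j, X j ∉ P := by
  by_contra! h
  refine hne ((maxGradedIdeal_isMaximal n K).eq_of_le hP ?_).symm
  rw [maxGradedIdeal, Ideal.span_le]
  rintro _ ⟨j, rfl⟩
  exact h j

/-- Lemma 2.9: for a monomial ideal `I` and every `t ≥ 1`,
`Ass(I^t) ∖ {𝔪} = ⋃_{j=1}^n Ass(I[x_j]^t)`. -/
theorem ass_minus_max_eq_union_sat (I : Ideal (MvPolynomial (Fin n) K))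
    (hI : IsMonomialIdeal I) (t : ℕ) (ht : 1 ≤ t) :
    associatedPrimes (MvPolynomial (Fin n) K) (MvPolynomial (Fin n) K ⧸ (I ^ t))
        \ {maxGradedIdeal n K} =
      ⋃ j : Fin n,
        associatedPrimes (MvPolynomial (Fin n) K)
          (MvPolynomial (Fin n) K ⧸ ((satVar I j) ^ t)) := by
  ext P
  simp only [Set.mem_sdiff, Set.mem_singleton_iff, Set.mem_iUnion]
  constructor
  · rintro ⟨hP, hne⟩
    obtain ⟨j, hj⟩ := exists_X_notMem_of_ne_maxGradedIdeal hP.isPrime.ne_top hne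
    exact ⟨j, (mem_associatedPrimes_pow_iff_satVar_pow hP.isPrime hj t).1 hP⟩
  · rintro ⟨j, hP⟩
    have hj := X_notMem_of_mem_associatedPrimes_satVar_pow hI hP
    refine ⟨(mem_associatedPrimes_pow_iff_satVar_pow hP.isPrime hj t).2 hP, ?_⟩
    rintro rfl
    exact hj (Ideal.subset_span ⟨j, rfl⟩)
end
end

section
/- Let n ≥ 4 and let G_ω be the weighted path on vertices x_1,…,x_n with edges x_i x_{i+1} for i ∈ [n−1], with weights ω(x_i x_{i+1}) = 1 for i ∈ [n−2] and ω(x_{n−1} x_n) = 2. Then astab(I(G_ω)) = n − 2; moreover, the prime ideal (x_1,…,x_{n−1}) is an associated prime of I(G_ω)^t if and only if t ≥ n − 2. -/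
open SimpleGraph MvPolynomial

noncomputable section

/-- The weighted edge ideal `I(G_ω) = ((x_i x_j)^{ω(x_i x_j)} ∣ x_i x_j ∈ E(G))`. -/
def weightedEdgeIdeal (n : ℕ) (K : Type*) [Field K]
    (G : SimpleGraph (Fin n)) (ω : Fin n → Fin n → ℕ) : Ideal (MvPolynomial (Fin n) K) :=
  Ideal.span {f | ∃ i j : Fin n, G.Adj i j ∧ f = (X i * X j) ^ ω i j}

/-- `astab(I)`: the smallest positive integer `t₀` such that `Ass(I^t) = Ass(I^{t₀})` for
all `t ≥ t₀`. -/
def astab {n : ℕ} {K : Type*} [Field K] (I : Ideal (MvPolynomial (Fin n) K)) : ℕ :=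
  sInf {t₀ : ℕ | 1 ≤ t₀ ∧ ∀ t : ℕ, t₀ ≤ t →
    associatedPrimes (MvPolynomial (Fin n) K) (MvPolynomial (Fin n) K ⧸ (I ^ t)) =
      associatedPrimes (MvPolynomial (Fin n) K) (MvPolynomial (Fin n) K ⧸ (I ^ t₀))}

/-- The path graph on `x_1, …, x_n` (indexed by `Fin n`), with edges `x_i x_{i+1}`. -/
def pathGraphN (n : ℕ) : SimpleGraph (Fin n) :=
  SimpleGraph.fromRel (fun i j => (i : ℕ) + 1 = (j : ℕ))

/-- The weight function: every edge has weight `1` except the last edge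
`x_{n-1} x_n`, which has weight `2`. -/
def pathWeight (n : ℕ) : Fin n → Fin n → ℕ :=
  fun i j => if (i : ℕ) = n - 1 ∨ (j : ℕ) = n - 1 then 2 else 1

/-- Greedy count of edges for the path with edges `{i, i+1}`, `i ≤ m`, whose edge `{0, 1}` has
weight `2`: the vertex `i ≤ m` carries the exponent `u i` and the leaf `m + 1` the exponent `b`. -/
def greedyCount : ℕ → (ℕ → ℕ) → ℕ → ℕ
  | 0, u, b => min b (u 0) / 2
  | m + 1, u, b => min b (u (m + 1)) + greedyCount m u (u (m + 1) - b)

/-- The largest power of the edge ideal of the path on `0, …, m + 1` containing the monomial with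
exponents `u`, where the edge `{0, 1}` has weight `2` and all others weight `1`. -/
def edgeOrder (m : ℕ) (u : ℕ → ℕ) : ℕ := greedyCount m u (u (m + 1))

/-- The exponent vector of the generator at the edge `{i, i + 1}`. -/
def edgeVec (i : ℕ) : ℕ → ℕ :=
  if i = 0 then Pi.single 0 2 + Pi.single 1 2 else Pi.single i 1 + Pi.single (i + 1) 1

lemma edgeVec_of_lt {i j : ℕ} (h : j < i) : edgeVec i j = 0 := by
  simp only [edgeVec]
  split_ifs <;> simp [Pi.single_apply] <;> omega

lemma edgeVec_of_gt {i j : ℕ} (h : i + 1 < j) : edgeVec i j = 0 := by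
  simp only [edgeVec]
  split_ifs <;> simp [Pi.single_apply] <;> omega

lemma greedyCount_congr {m : ℕ} {u w : ℕ → ℕ} (h : ∀ i ≤ m, u i = w i) (b : ℕ) :
    greedyCount m u b = greedyCount m w b := by
  induction m generalizing b with
  | zero => simp [greedyCount, h 0 le_rfl]
  | succ m ih =>
    simp only [greedyCount, h (m + 1) le_rfl, ih fun i hi => h i (by omega)]

lemma edgeOrder_congr {m : ℕ} {u w : ℕ → ℕ} (h : ∀ i ≤ m + 1, u i = w i) :
    edgeOrder m u = edgeOrder m w := by
  rw [edgeOrder, edgeOrder, h _ le_rfl, greedyCount_congr fun i hi => h i (by omega)]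

lemma greedyCount_succ_bounds (m : ℕ) (u : ℕ → ℕ) (b : ℕ) :
    greedyCount m u b ≤ greedyCount m u (b + 1) ∧
      greedyCount m u (b + 1) ≤ greedyCount m u b + 1 := by
  induction m generalizing b with
  | zero => simp only [greedyCount]; omega
  | succ m ih =>
    simp only [greedyCount]
    rcases lt_or_ge b (u (m + 1)) with h | h
    · have := ih (u (m + 1) - (b + 1))
      rw [show u (m + 1) - (b + 1) + 1 = u (m + 1) - b by omega] at this
      omega
    · rw [show u (m + 1) - (b + 1) = 0 by omega, show u (m + 1) - b = 0 by omega]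
      omega

lemma greedyCount_add_bounds (m : ℕ) (u : ℕ → ℕ) (b d : ℕ) :
    greedyCount m u b ≤ greedyCount m u (b + d) ∧
      greedyCount m u (b + d) ≤ greedyCount m u b + d := by
  induction d with
  | zero => simp
  | succ d ih =>
    have := greedyCount_succ_bounds m u (b + d)
    rw [← add_assoc]
    omega

lemma greedyCount_le_add_sub (m : ℕ) (u : ℕ → ℕ) (b c : ℕ) :
    greedyCount m u b ≤ greedyCount m u c + (b - c) := by
  rcases le_total b c with h | h
  · have := (greedyCount_add_bounds m u b (c - b)).1
    rw [Nat.add_sub_cancel' h] at this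
    omega
  · have := (greedyCount_add_bounds m u c (b - c)).2
    rwa [Nat.add_sub_cancel' h] at this

lemma greedyCount_mono {m : ℕ} {u w : ℕ → ℕ} (h : u ≤ w) {b c : ℕ} (hbc : b ≤ c) :
    greedyCount m u b ≤ greedyCount m w c := by
  induction m generalizing b c with
  | zero =>
    have h0 : u 0 ≤ w 0 := h 0
    simp only [greedyCount]
    omega
  | succ m ih =>
    have h1 : u (m + 1) ≤ w (m + 1) := h (m + 1)
    have h2 := greedyCount_le_add_sub m u (u (m + 1) - b) (w (m + 1) - c)
    have h3 := ih (le_refl (w (m + 1) - c))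
    simp only [greedyCount]
    omega

lemma edgeOrder_mono {m : ℕ} {u w : ℕ → ℕ} (h : u ≤ w) : edgeOrder m u ≤ edgeOrder m w :=
  greedyCount_mono h (h _)

lemma greedyCount_add_single_le (m : ℕ) (u : ℕ → ℕ) (i b : ℕ) :
    greedyCount m (u + Pi.single i 1) b ≤ greedyCount m u b + 1 := by
  induction m generalizing b with
  | zero =>
    have : (Pi.single i 1 : ℕ → ℕ) 0 ≤ 1 := by simp only [Pi.single_apply]; split_ifs <;> omega
    simp only [greedyCount, Pi.add_apply]
    omega
  | succ m ih =>
    simp only [greedyCount]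
    by_cases hi : i = m + 1
    · subst hi
      have h1 := fun b => greedyCount_congr (m := m) (u := u + Pi.single (m + 1) 1) (w := u)
        (fun i hi => by simp [Pi.single_apply]; omega) b
      rw [h1]
      simp only [Pi.add_apply, Pi.single_eq_same]
      have := greedyCount_le_add_sub m u (u (m + 1) + 1 - b) (u (m + 1) - b)
      omega
    · have h1 : (u + Pi.single i 1 : ℕ → ℕ) (m + 1) = u (m + 1) := by
        simp [Pi.single_apply]; omega
      rw [h1]
      have := ih (u (m + 1) - b)
      omega

lemma edgeOrder_add_single_le (m : ℕ) (u : ℕ → ℕ) (i : ℕ) :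
    edgeOrder m (u + Pi.single i 1) ≤ edgeOrder m u + 1 := by
  by_cases hi : i = m + 1
  · subst hi
    have h1 := fun b => greedyCount_congr (m := m) (u := u + Pi.single (m + 1) 1) (w := u)
      (fun i hi => by simp [Pi.single_apply]; omega) b
    simp only [edgeOrder, h1, Pi.add_apply, Pi.single_eq_same]
    exact (greedyCount_succ_bounds m u _).2
  · have h1 : (u + Pi.single i 1 : ℕ → ℕ) (m + 1) = u (m + 1) := by
      simp [Pi.single_apply]; omega
    rw [edgeOrder, h1]
    exact greedyCount_add_single_le m u i _

lemma edgeOrder_succ_of_eq_zero {m : ℕ} {u : ℕ → ℕ} (h : u (m + 1) = 0 ∨ u (m + 2) = 0) :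
    edgeOrder (m + 1) u = edgeOrder m u := by
  rcases h with h | h <;> simp [edgeOrder, greedyCount, h]

lemma edgeOrder_succ_of_leaf_eq_one {m : ℕ} {u w : ℕ → ℕ} (h2 : u (m + 2) = 1)
    (h1 : u (m + 1) = w (m + 1) + 1) (h : ∀ i ≤ m, u i = w i) :
    edgeOrder (m + 1) u = edgeOrder m w + 1 := by
  simp only [edgeOrder, greedyCount, h2, h1, greedyCount_congr h, Nat.add_sub_cancel]
  omega

lemma greedyCount_add_edgeVec_self (m : ℕ) (u : ℕ → ℕ) (b : ℕ) :
    greedyCount m (u + edgeVec m) (b + edgeVec m (m + 1)) = greedyCount m u b + 1 := by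
  cases m with
  | zero => simp [greedyCount, edgeVec]
  | succ m =>
    have h := fun b => greedyCount_congr (m := m) (u := u + edgeVec (m + 1)) (w := u)
      (fun i hi => by simp [edgeVec_of_lt (show i < m + 1 by omega)]) b
    simp only [greedyCount, h]
    simp [edgeVec]
    omega

lemma edgeOrder_add_edgeVec_self (m : ℕ) (u : ℕ → ℕ) :
    edgeOrder m (u + edgeVec m) = edgeOrder m u + 1 :=
  greedyCount_add_edgeVec_self m u _

lemma lt_greedyCount_add_edgeVec {m i : ℕ} (hi : i < m) (u : ℕ → ℕ) (b : ℕ) :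
    greedyCount m u b < greedyCount m (u + edgeVec i) b := by
  induction m generalizing b with
  | zero => omega
  | succ m ih =>
    simp only [greedyCount]
    by_cases h : i = m
    · subst h
      have h1 := greedyCount_add_edgeVec_self i u
      have h2 := fun b => greedyCount_mono (m := i) (u := u) (w := u + edgeVec i)
        (by simp) (le_refl b)
      have h3 : edgeVec i (i + 1) = 1 ∨ edgeVec i (i + 1) = 2 := by
        simp only [edgeVec]; split_ifs with h <;> simp [h]
      simp only [Pi.add_apply]
      have h4 := h1 (u (i + 1) - b)
      have h5 := h2 (u (i + 1) + edgeVec i (i + 1) - b)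
      rcases le_or_gt b (u (i + 1)) with hb | hb
      · rw [show u (i + 1) + edgeVec i (i + 1) - b = u (i + 1) - b + edgeVec i (i + 1) by omega]
        omega
      · have h6 := greedyCount_le_add_sub i u (u (i + 1) - b) (u (i + 1) + edgeVec i (i + 1) - b)
        omega
    · have := ih (by omega) (u (m + 1) - b)
      have h1 : edgeVec i (m + 1) = 0 := edgeVec_of_gt (by omega)
      simp only [Pi.add_apply, h1, add_zero]
      omega

lemma lt_edgeOrder_add_edgeVec {m i : ℕ} (hi : i ≤ m) (u : ℕ → ℕ) :
    edgeOrder m u < edgeOrder m (u + edgeVec i) := by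
  rcases hi.eq_or_lt with rfl | hi
  · simp [edgeOrder_add_edgeVec_self]
  · exact (lt_greedyCount_add_edgeVec hi u _).trans_le
      (greedyCount_mono le_rfl (by simp))

lemma edgeVec_succ_le {m : ℕ} {u : ℕ → ℕ} (h1 : u (m + 1) ≠ 0) (h2 : u (m + 2) ≠ 0) :
    edgeVec (m + 1) ≤ u := by
  intro i
  change u (m + 1 + 1) ≠ 0 at h2
  simp only [edgeVec, Nat.succ_ne_zero, if_false, Pi.add_apply, Pi.single_apply]
  split_ifs with h h' h' <;> subst_vars <;> omega

lemma edgeVec_zero_le {u : ℕ → ℕ} (h1 : 2 ≤ u 0) (h2 : 2 ≤ u 1) : edgeVec 0 ≤ u := by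
  intro i
  simp only [edgeVec, if_true, Pi.add_apply, Pi.single_apply]
  split_ifs with h h' h' <;> subst_vars <;> omega

lemma exists_edgeVec_le {m t : ℕ} {u : ℕ → ℕ} (h : t < edgeOrder m u) :
    ∃ i ≤ m, ∃ w, u = w + edgeVec i ∧ t ≤ edgeOrder m w := by
  have key : ∀ m, edgeVec m ≤ u → t < edgeOrder m u →
      ∃ i ≤ m, ∃ w, u = w + edgeVec i ∧ t ≤ edgeOrder m w := by
    intro m hm h
    have h1 := tsub_add_cancel_of_le hm
    refine ⟨m, le_rfl, u - edgeVec m, h1.symm, ?_⟩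
    have h2 := edgeOrder_add_edgeVec_self m (u - edgeVec m)
    rw [h1] at h2
    omega
  induction m with
  | zero =>
    refine key 0 ?_ h
    simp only [edgeOrder, greedyCount, zero_add] at h
    exact edgeVec_zero_le (by omega) (by omega)
  | succ m ih =>
    by_cases h0 : u (m + 1) = 0 ∨ u (m + 2) = 0
    · rw [edgeOrder_succ_of_eq_zero h0] at h
      obtain ⟨i, hi, w, hw, ht⟩ := ih h
      refine ⟨i, by omega, w, hw, ?_⟩
      rw [edgeOrder_succ_of_eq_zero]
      · exact ht
      · have h1 := congrFun hw (m + 1)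
        have h2 := congrFun hw (m + 2)
        simp only [Pi.add_apply] at h1 h2
        omega
    · rw [not_or] at h0
      exact key _ (edgeVec_succ_le h0.1 h0.2) h

/-- The monomial with exponents `u` certifies that the prime generated by the variables in `C` is
associated to the `t`-th power of the edge ideal of the path on `0, …, m + 1`. -/
structure IsWitness (m : ℕ) (C : ℕ → Prop) (t : ℕ) (u : ℕ → ℕ) : Prop where
  le_order : ∀ i ≤ m + 1, C i → t ≤ edgeOrder m (u + Pi.single i 1)
  order_lt : ∀ v : ℕ → ℕ, (∀ i, C i → v i = 0) → edgeOrder m (u + v) < t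

namespace IsWitness

variable {m t : ℕ} {C : ℕ → Prop} {u w : ℕ → ℕ}

lemma order_lt_self (h : IsWitness m C t u) : edgeOrder m u < t := by
  simpa using h.order_lt 0 (by simp)

lemma congr (h : IsWitness m C t u) (huw : ∀ i ≤ m + 1, u i = w i) : IsWitness m C t w where
  le_order i hi hC := by
    rw [← edgeOrder_congr (u := u + Pi.single i 1) fun j hj => by simp [huw j hj]]
    exact h.le_order i hi hC
  order_lt v hv := by
    rw [← edgeOrder_congr (u := u + v) fun j hj => by simp [huw j hj]]
    exact h.order_lt v hv

lemma add_edgeVec_iff : IsWitness m C (t + 1) (u + edgeVec m) ↔ IsWitness m C t u := by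
  constructor <;> intro h <;> constructor
  · intro i hi hC
    have := h.le_order i hi hC
    rw [add_right_comm, edgeOrder_add_edgeVec_self] at this
    omega
  · intro v hv
    have := h.order_lt v hv
    rw [add_right_comm, edgeOrder_add_edgeVec_self] at this
    omega
  · intro i hi hC
    have := h.le_order i hi hC
    rw [add_right_comm, edgeOrder_add_edgeVec_self]
    omega
  · intro v hv
    have := h.order_lt v hv
    rw [add_right_comm, edgeOrder_add_edgeVec_self]
    omega

lemma sub_edgeVec (h : IsWitness m C (t + 1) u) (hu : edgeVec m ≤ u) :
    IsWitness m C t (u - edgeVec m) := by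
  rw [← add_edgeVec_iff, tsub_add_cancel_of_le hu]
  exact h

lemma add_of_forall_eq_zero (h : IsWitness m C t u) {v : ℕ → ℕ} (hv : ∀ i, C i → v i = 0) :
    IsWitness m C t (u + v) where
  le_order i hi hC := (h.le_order i hi hC).trans (edgeOrder_mono (by gcongr; simp))
  order_lt v' hv' := by
    rw [add_assoc]
    exact h.order_lt _ fun i hi => by simp [hv i hi, hv' i hi]

lemma mem_or_mem (h : IsWitness m C t u) : C m ∨ C (m + 1) := by
  classical
  by_contra! hC
  have h1 := h.order_lt (fun i => if C i then 0 else 2 * t) (by intro i hi; simp [hi])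
  cases m <;> simp only [edgeOrder, greedyCount, Pi.add_apply, hC, zero_add] at h1 <;>
    simp at h1 <;> omega

lemma le_order_self (h : IsWitness m C (t + 1) u) : t ≤ edgeOrder m u := by
  have : ∀ i ≤ m + 1, C i → t ≤ edgeOrder m u := by
    intro i hi hC
    have h1 := h.le_order i hi hC
    have h2 := edgeOrder_add_single_le m u i
    omega
  rcases h.mem_or_mem with hC | hC
  · exact this _ (by omega) hC
  · exact this _ le_rfl hC

lemma exists_succ_of_not_mem (h : IsWitness m C (t + 1) u) (h2 : C (m + 2)) (h1 : ¬ C (m + 1)) :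
    ∃ w, IsWitness (m + 1) C (t + 1) w := by
  have hs : ∀ i, C i → (Pi.single (m + 1) 1 : ℕ → ℕ) i = 0 := fun i hi => by
    rw [Pi.single_eq_of_ne]; rintro rfl; exact h1 hi
  have hu := h.congr (w := Function.update u (m + 2) 0)
    fun i hi => by rw [Function.update_of_ne (by omega)]
  set u' := Function.update u (m + 2) 0 with hu'
  have h0 : u' (m + 2) = 0 := by simp [hu']
  have hw := hu.add_of_forall_eq_zero hs
  refine ⟨u' + Pi.single (m + 1) 1, fun i hi hC => ?_, fun v hv => ?_⟩
  · rcases hi.eq_or_lt with rfl | hi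
    · rw [edgeOrder_succ_of_leaf_eq_one (w := u')]
      · have := hu.le_order_self
        omega
      · simp [h0]
      · simp
      · intro i hi
        simp [show i ≠ m + 1 by omega, show i ≠ m + 2 by omega]
    · rw [edgeOrder_succ_of_eq_zero]
      · exact hw.le_order i (by omega) hC
      · right
        simp [h0, Pi.single_apply]
        omega
  · rw [edgeOrder_succ_of_eq_zero]
    · exact hw.order_lt v hv
    · right
      simp [h0, hv _ h2]

lemma exists_succ_of_mem (h : IsWitness (m + 1) C t u) (h1 : C (m + 1)) (h3 : C (m + 3)) :
    ∃ w, IsWitness (m + 2) C (t + 1) w := by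
  have hu := h.congr (w := Function.update u (m + 3) 0)
    fun i hi => by rw [Function.update_of_ne (by omega)]
  set u' := Function.update u (m + 3) 0 with hu'
  have h0 : u' (m + 3) = 0 := by simp [hu']
  have hw := add_edgeVec_iff.2 hu
  refine ⟨u' + edgeVec (m + 1), fun i hi hC => ?_, fun v hv => ?_⟩
  · rcases hi.eq_or_lt with rfl | hi
    · rw [edgeOrder_succ_of_leaf_eq_one (w := u' + Pi.single (m + 1) 1)]
      · have := hu.le_order _ (by omega) h1
        omega
      · simp [h0, edgeVec]
      · simp [edgeVec]
      · intro i hi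
        simp [edgeVec, show i ≠ m + 2 by omega, show i ≠ m + 3 by omega]
    · rw [edgeOrder_succ_of_eq_zero]
      · exact hw.le_order i (by omega) hC
      · right
        simp [h0, edgeVec, Pi.single_apply]
        omega
  · rw [edgeOrder_succ_of_eq_zero]
    · exact hw.order_lt v hv
    · right
      simp [h0, hv _ h3, edgeVec]

lemma exists_add_two (h : IsWitness m C (t + 1) u) (h3 : ¬ C (m + 3)) (h2 : C (m + 2)) :
    ∃ w, IsWitness (m + 2) C (t + 1) w := by
  have hu := h.congr (w := Function.update (Function.update u (m + 2) 0) (m + 3) 1)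
    fun i hi => by rw [Function.update_of_ne (by omega), Function.update_of_ne (by omega)]
  set u' := Function.update (Function.update u (m + 2) 0) (m + 3) 1 with hu'
  have h02 : u' (m + 2) = 0 := by simp [hu']
  have h03 : u' (m + 3) = 1 := by simp [hu']
  refine ⟨u', fun i hi hC => ?_, fun v hv => ?_⟩
  · rcases hi.eq_or_lt with rfl | hi
    · exact absurd hC h3
    by_cases hi' : i = m + 2
    · subst hi'
      rw [edgeOrder_succ_of_leaf_eq_one (w := u'), edgeOrder_succ_of_eq_zero (Or.inr h02)]
      · have := hu.le_order_self
        omega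
      · simp [h03]
      · simp
      · intro i hi
        simp [Pi.single_apply]
        omega
    · have : (u' + Pi.single i 1 : ℕ → ℕ) (m + 2) = 0 := by
        simp [h02, Pi.single_apply]
        omega
      rw [edgeOrder_succ_of_eq_zero (Or.inl this), edgeOrder_succ_of_eq_zero (Or.inr this)]
      exact hu.le_order i (by omega) hC
  · have : (u' + v) (m + 2) = 0 := by simp [h02, hv _ h2]
    rw [edgeOrder_succ_of_eq_zero (Or.inl this), edgeOrder_succ_of_eq_zero (Or.inr this)]
    exact hu.order_lt v hv

lemma cases_succ (h : IsWitness (m + 1) C (t + 1) u) :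
    (∃ w, IsWitness (m + 1) C t w) ∨
      (C (m + 2) ∧ u (m + 2) = 0 ∧ u (m + 1) ≠ 0 ∧ IsWitness m C (t + 1) u) ∨
      (¬ C (m + 2) ∧ C (m + 1) ∧ u (m + 1) = 0) := by
  by_cases h2 : C (m + 2)
  · by_cases hu1 : u (m + 1) = 0
    · have h3 := h.le_order _ le_rfl h2
      have h4 := h.order_lt_self
      rw [edgeOrder_succ_of_eq_zero (Or.inl (by simp [hu1]))] at h3 h4
      rw [edgeOrder_congr (w := u) fun i hi => by simp [Pi.single_apply]; omega] at h3
      omega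
    by_cases hu2 : u (m + 2) = 0
    · right; left
      refine ⟨h2, hu2, hu1, fun i hi hC => ?_, fun v hv => ?_⟩
      · rw [← edgeOrder_succ_of_eq_zero]
        · exact h.le_order i (by omega) hC
        · right; simp [hu2, Pi.single_apply]; omega
      · rw [← edgeOrder_succ_of_eq_zero]
        · exact h.order_lt v hv
        · right; simp [hu2, hv _ h2]
    · exact Or.inl ⟨_, h.sub_edgeVec (edgeVec_succ_le hu1 hu2)⟩
  · have hC := h.mem_or_mem.resolve_right h2
    by_cases hu1 : u (m + 1) = 0
    · exact Or.inr (Or.inr ⟨h2, hC, hu1⟩)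
    · left
      have hw := h.add_of_forall_eq_zero (v := Pi.single (m + 2) 1) fun i hi => by
        rw [Pi.single_eq_of_ne]; rintro rfl; exact h2 hi
      exact ⟨_, hw.sub_edgeVec (edgeVec_succ_le (by simp [hu1]) (by simp))⟩

lemma lt_of_leaf_mem (h : IsWitness (m + 1) C t u) (hC : C (m + 2)) : u (m + 2) < u (m + 1) := by
  by_contra! hle
  have h1 : t ≤ edgeOrder (m + 1) (u + Pi.single (m + 2) 1) := h.le_order _ le_rfl hC
  have h2 := h.order_lt_self
  have h3 : edgeOrder (m + 1) (u + Pi.single (m + 2) 1) = edgeOrder (m + 1) u := by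
    have h4 := fun b => greedyCount_congr (m := m) (u := u + Pi.single (m + 2) 1) (w := u)
      (fun i hi => by simp [Pi.single_apply]; omega) b
    simp only [edgeOrder, greedyCount, h4, show m + 1 + 1 = m + 2 from rfl]
    simp
    rw [show u (m + 1) - (u (m + 2) + 1) = u (m + 1) - u (m + 2) by omega]
    omega
  omega

lemma mem_and_exists_of_leaf_mem (h : IsWitness (m + 2) C (t + 1) u)
    (hu : IsWitness (m + 1) C (t + 1) u) (h0 : u (m + 3) = 0) (h3 : C (m + 3)) (h2 : C (m + 2))
    (hu2 : u (m + 2) ≠ 0) : C (m + 1) ∧ ∃ w, IsWitness (m + 1) C t w := by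
  have hu1 := hu.lt_of_leaf_mem h2
  have hle := edgeVec_succ_le (u := u) (m := m) (by omega) hu2
  have hw := hu.sub_edgeVec hle
  have hadd := tsub_add_cancel_of_le hle
  refine ⟨?_, _, hw⟩
  by_contra hC
  have h4 := hw.order_lt (Pi.single (m + 1) 1) fun i hi => by
    rw [Pi.single_eq_of_ne]; rintro rfl; exact hC hi
  have h5 := h.le_order _ le_rfl h3
  rw [edgeOrder_succ_of_leaf_eq_one (w := u - edgeVec (m + 1) + Pi.single (m + 1) 1)] at h5
  · omega
  · simp [h0]
  · conv_lhs => rw [← hadd]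
    simp [edgeVec]
  · intro i hi
    conv_lhs => rw [← hadd]
    simp [edgeVec, show i ≠ m + 2 by omega, show i ≠ m + 3 by omega]

lemma sub_edgeVec_zero (h : IsWitness 0 C (t + 2) u) : IsWitness 0 C (t + 1) (u - edgeVec 0) := by
  refine h.sub_edgeVec ?_
  have h1 : ∀ i ≤ 1, t + 2 ≤ edgeOrder 0 (u + Pi.single i 1) → edgeVec 0 ≤ u := by
    intro i hi h
    have h1 : (Pi.single i 1 : ℕ → ℕ) 0 ≤ 1 := by
      simp only [Pi.single_apply]; split_ifs <;> omega
    have h2 : (Pi.single i 1 : ℕ → ℕ) 1 ≤ 1 := by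
      simp only [Pi.single_apply]; split_ifs <;> omega
    simp only [edgeOrder, greedyCount, Pi.add_apply, zero_add] at h
    exact edgeVec_zero_le (by omega) (by omega)
  rcases h.mem_or_mem with hC | hC
  · exact h1 0 (by omega) (h.le_order _ (by omega) hC)
  · exact h1 1 (by omega) (h.le_order _ (by omega) hC)

lemma exists_of_one (hu : IsWitness 0 C (t + 2) u) (h0 : u 2 = 0) (h2 : C 2) (h1 : C 1) :
    IsWitness 1 C (t + 1) (u - edgeVec 0) := by
  have hw := hu.sub_edgeVec_zero
  have h3 := hu.le_order 1 (by omega) h1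
  have h4 := hu.order_lt_self
  simp only [edgeOrder, greedyCount, Pi.add_apply, zero_add, Pi.single_eq_same] at h3 h4
  simp at h3
  have e0 : (u - edgeVec 0) 0 = u 0 - 2 := by simp [edgeVec]
  have e1 : (u - edgeVec 0) 1 = u 1 - 2 := by simp [edgeVec]
  have e2 : (u - edgeVec 0) 2 = 0 := by simp [edgeVec, h0]
  refine ⟨fun i hi hC => ?_, fun v hv => ?_⟩
  · rcases hi.eq_or_lt with rfl | hi
    · simp [edgeOrder, greedyCount, -Pi.sub_apply, e0, e1, e2]
      omega
    · rw [edgeOrder_succ_of_eq_zero]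
      · exact hw.le_order i (by omega) hC
      · right; rw [Pi.add_apply, e2]; simp [Pi.single_apply]; omega
  · rw [edgeOrder_succ_of_eq_zero]
    · exact hw.order_lt v hv
    · right; rw [Pi.add_apply, e2, hv _ h2]

theorem exists_of_succ (ht : 1 ≤ t) (hm : m ≤ t) (h : IsWitness m C (t + 1) u) :
    ∃ w, IsWitness m C t w := by
  induction m using Nat.strong_induction_on generalizing t u with
  | _ m ih =>
    obtain ⟨t, rfl⟩ := Nat.exists_eq_add_of_le' ht
    match m with
    | 0 => exact ⟨_, h.sub_edgeVec_zero⟩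
    | m + 1 =>
      rcases h.cases_succ with h' | ⟨h2, hu2, hu1, hw⟩ | ⟨h2, h1, hu1⟩
      · exact h'
      · by_cases h1 : C (m + 1)
        · match m with
          | 0 => exact ⟨_, hw.exists_of_one hu2 h2 h1⟩
          | m + 1 =>
            obtain ⟨hC, w, hw'⟩ := h.mem_and_exists_of_leaf_mem hw hu2 h2 h1 hu1
            obtain ⟨w', hw''⟩ := ih _ (by omega) (by omega) (by omega) hw'
            exact hw''.exists_succ_of_mem hC h2
        · obtain ⟨w, hw'⟩ := ih _ (by omega) ht (by omega) hw
          exact hw'.exists_succ_of_not_mem h2 h1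
      · match m with
        | 0 =>
          have h3 := h.le_order 1 (by omega) h1
          simp [edgeOrder, greedyCount, hu1] at h3
          omega
        | m + 1 =>
          have hw : IsWitness m C (t + 1 + 1) u := by
            refine ⟨fun i hi hC => ?_, fun v hv => ?_⟩
            · have : (u + Pi.single i 1 : ℕ → ℕ) (m + 2) = 0 := by
                simp [hu1, Pi.single_apply]; omega
              rw [← edgeOrder_succ_of_eq_zero (Or.inr this),
                ← edgeOrder_succ_of_eq_zero (Or.inl this)]
              exact h.le_order i (by omega) hC
            · have : (u + v) (m + 2) = 0 := by simp [hu1, hv _ h1]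
              rw [← edgeOrder_succ_of_eq_zero (Or.inr this),
                ← edgeOrder_succ_of_eq_zero (Or.inl this)]
              exact h.order_lt v hv
          obtain ⟨w, hw'⟩ := ih _ (by omega) ht (by omega) hw
          exact hw'.exists_add_two h2 h1

theorem le_of_forall_mem (hC : ∀ i, 1 ≤ i → i ≤ m + 1 → C i) (h : IsWitness m C t u) :
    m ≤ t := by
  induction m generalizing t u with
  | zero => omega
  | succ m ih =>
    induction t generalizing u with
    | zero => exact absurd h.order_lt_self (by omega)
    | succ t iht =>
      rcases h.cases_succ with ⟨w, h'⟩ | ⟨h2, hu2, hu1, hw⟩ | ⟨h2, -, -⟩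
      · have := iht h'
        omega
      · match m with
        | 0 => omega
        | m + 1 =>
          obtain ⟨-, w, hw'⟩ :=
            h.mem_and_exists_of_leaf_mem hw hu2 h2 (hC _ (by omega) (by omega)) hu1
          have := ih (fun i h1 h2 => hC i h1 (by omega)) hw'
          omega
      · exact absurd (hC _ (by omega) le_rfl) h2

theorem exists_of_forall_mem (hm : 1 ≤ m) (hC : ∀ i, 1 ≤ i → i ≤ m + 1 → C i) (hC0 : ¬ C 0)
    (ht : m ≤ t) : ∃ u, IsWitness m C t u := by
  induction t, ht using Nat.le_induction with
  | succ t ht ih =>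
    obtain ⟨u, hu⟩ := ih
    exact ⟨_, add_edgeVec_iff.2 hu⟩
  | base =>
    induction m, hm using Nat.le_induction with
    | base =>
      refine ⟨Pi.single 0 2 + Pi.single 1 1, fun i hi hCi => ?_, fun v hv => ?_⟩
      · interval_cases i
        · exact absurd hCi hC0
        · simp [edgeOrder, greedyCount]
        · simp [edgeOrder, greedyCount]
      · have h1 := hv 1 (hC 1 (by omega) (by omega))
        have h2 := hv 2 (hC 2 (by omega) (by omega))
        simp [edgeOrder, greedyCount, h1, h2]
    | succ m hm ih =>
      obtain ⟨u, hu⟩ := ih fun i h1 h2 => hC i h1 (by omega)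
      obtain ⟨m, rfl⟩ := Nat.exists_eq_add_of_le' hm
      exact hu.exists_succ_of_mem (hC _ (by omega) (by omega)) (hC _ (by omega) (by omega))

end IsWitness

section MonomialIdeal

variable {σ K : Type*} [Field K]

lemma card_support_monomial_mul_le (d : σ →₀ ℕ) (c : K) (q : MvPolynomial σ K) :
    (monomial d c * q).support.card ≤ q.support.card := by
  classical
  refine (Finset.card_le_card (support_mul _ _)).trans (Finset.card_add_le.trans ?_)
  calc _ ≤ 1 * q.support.card :=
        Nat.mul_le_mul_right _ (Finset.card_le_card support_monomial_subset)
    _ = _ := one_mul _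

lemma mem_support_sub_monomial {p : MvPolynomial σ K} {d u : σ →₀ ℕ} :
    u ∈ (p - monomial d (p.coeff d)).support ↔ u ∈ p.support ∧ u ≠ d := by
  classical
  simp only [mem_support_iff, coeff_sub, coeff_monomial]
  by_cases h : d = u
  · simp [h]
  · simp [h, Ne.symm h]

lemma card_support_sub_monomial_lt {p : MvPolynomial σ K} {d : σ →₀ ℕ} (hd : d ∈ p.support) :
    (p - monomial d (p.coeff d)).support.card < p.support.card :=
  Finset.card_lt_card ⟨fun _ hu => (mem_support_sub_monomial.1 hu).1,
    fun h => (mem_support_sub_monomial.1 (h hd)).2 rfl⟩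

lemma mem_span_X_image_monomial {T : Set σ} {u : σ →₀ ℕ} :
    monomial u (1 : K) ∈ Ideal.span (X '' T : Set (MvPolynomial σ K)) ↔ ∃ i ∈ T, u i ≠ 0 := by
  classical
  rw [mem_ideal_span_X_image, support_monomial, if_neg one_ne_zero]
  simp

lemma X_mem_span_X_image {T : Set σ} {i : σ} :
    (X i : MvPolynomial σ K) ∈ Ideal.span (X '' T : Set (MvPolynomial σ K)) ↔ i ∈ T := by
  classical
  rw [X, mem_span_X_image_monomial]
  simp [Finsupp.single_apply]

lemma isPrime_span_X_image (T : Set σ) :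
    (Ideal.span (X '' T : Set (MvPolynomial σ K))).IsPrime := by
  classical
  let φ : MvPolynomial σ K →ₐ[K] MvPolynomial σ K := aeval fun i => if i ∈ T then 0 else X i
  let J := Ideal.span (X '' T : Set (MvPolynomial σ K))
  have hcomp : (Ideal.Quotient.mkₐ K J).comp φ = Ideal.Quotient.mkₐ K J := by
    ext i
    by_cases hi : i ∈ T
    · have : (Ideal.Quotient.mk J) (X i) = 0 :=
        Ideal.Quotient.eq_zero_iff_mem.2 (X_mem_span_X_image.2 hi)
      simp [φ, hi, this]
    · simp [φ, hi]
  have hker : J = RingHom.ker φ := by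
    refine le_antisymm (Ideal.span_le.2 ?_) fun p hp => ?_
    · rintro _ ⟨i, hi, rfl⟩
      simp [φ, hi]
    · rw [← Ideal.Quotient.eq_zero_iff_mem]
      have := DFunLike.congr_fun hcomp p
      simpa [(RingHom.mem_ker).1 hp] using this.symm
  change J.IsPrime
  rw [hker]
  exact RingHom.ker_isPrime _

variable {J P : Ideal (MvPolynomial σ K)} {S : Set (σ →₀ ℕ)}

/-- If a prime is the annihilator of an element modulo a monomial ideal, then it contains the
leading monomials of its elements. -/
lemma monomial_degree_mem_of_colon (mo : MonomialOrder σ)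
    (hJ : ∀ p, p ∈ J ↔ ∀ u ∈ p.support, u ∈ S) (hP : P.IsPrime) (f : MvPolynomial σ K)
    (hf : ∀ r, r ∈ P ↔ r * f ∈ J) {p : MvPolynomial σ K} (hp : p ∈ P) (hp0 : p ≠ 0) :
    monomial (mo.degree p) (1 : K) ∈ P := by
  induction hk : f.support.card using Nat.strong_induction_on generalizing f with
  | _ k ih =>
    subst hk
    by_contra hd
    have hf0 : f ≠ 0 := by
      rintro rfl
      exact hP.ne_top (Ideal.eq_top_iff_one _ |>.2 ((hf 1).2 (by simp)))
    set d := mo.degree p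
    set g := mo.degree f
    have hS : d + g ∈ S := by
      refine (hJ _).1 ((hf p).1 hp) _ ?_
      rw [mem_support_iff, mo.coeff_mul_of_degree_add]
      exact mul_ne_zero (mo.leadingCoeff_ne_zero_iff.2 hp0) (mo.leadingCoeff_ne_zero_iff.2 hf0)
    have hlead : monomial d (1 : K) * monomial g (f.coeff g) ∈ J := by
      rw [hJ, monomial_mul]
      intro u hu
      rw [Finset.mem_singleton.1 (support_monomial_subset hu)]
      exact hS
    refine hd (ih _ ?_ (monomial d 1 * (f - monomial g (f.coeff g))) (fun r => ?_) rfl)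
    · exact (card_support_monomial_mul_le _ _ _).trans_lt
        (card_support_sub_monomial_lt (mo.degree_mem_support hf0))
    · have h1 : r * (monomial d 1 * (f - monomial g (f.coeff g))) =
          r * monomial d 1 * f - r * (monomial d 1 * monomial g (f.coeff g)) := by ring
      rw [h1, Submodule.sub_mem_iff_left _ (J.mul_mem_left r hlead), ← hf]
      exact ⟨fun h => P.mul_mem_right _ h, fun h => (hP.mem_or_mem h).resolve_right hd⟩

lemma monomial_mem_of_colon (mo : MonomialOrder σ)
    (hJ : ∀ p, p ∈ J ↔ ∀ u ∈ p.support, u ∈ S) (hP : P.IsPrime) (f : MvPolynomial σ K)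
    (hf : ∀ r, r ∈ P ↔ r * f ∈ J) {p : MvPolynomial σ K} (hp : p ∈ P) {u : σ →₀ ℕ}
    (hu : u ∈ p.support) : monomial u (1 : K) ∈ P := by
  induction hk : p.support.card using Nat.strong_induction_on generalizing p with
  | _ k ih =>
    subst hk
    have hp0 : p ≠ 0 := by rintro rfl; simp at hu
    have hlead := monomial_degree_mem_of_colon mo hJ hP f hf hp hp0
    by_cases h : u = mo.degree p
    · rwa [h]
    · refine ih _ (card_support_sub_monomial_lt (mo.degree_mem_support hp0))
        (P.sub_mem hp ?_) ?_ rfl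
      · rw [← mul_one (coeff _ p), ← C_mul_monomial]
        exact P.mul_mem_left _ hlead
      · exact mem_support_sub_monomial.2 ⟨hu, h⟩

lemma eq_span_X_of_colon (mo : MonomialOrder σ)
    (hJ : ∀ p, p ∈ J ↔ ∀ u ∈ p.support, u ∈ S) (hP : P.IsPrime) (f : MvPolynomial σ K)
    (hf : ∀ r, r ∈ P ↔ r * f ∈ J) : P = Ideal.span (X '' {i | (X i : MvPolynomial σ K) ∈ P}) := by
  refine le_antisymm (fun p hp => mem_ideal_span_X_image.2 fun u hu => ?_) (Ideal.span_le.2 ?_)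
  · have h := monomial_mem_of_colon mo hJ hP f hf hp hu
    rw [monomial_eq, C_1, one_mul, Finsupp.prod, hP.prod_mem_iff] at h
    obtain ⟨i, hi, h⟩ := h
    exact ⟨i, hP.mem_of_pow_mem _ h, Finsupp.mem_support_iff.1 hi⟩
  · rintro _ ⟨i, hi, rfl⟩
    exact hi

theorem mem_associatedPrimes_iff_of_monomial [Finite σ] (mo : MonomialOrder σ)
    (hS : IsUpperSet S) (hJ : ∀ p, p ∈ J ↔ ∀ u ∈ p.support, u ∈ S) :
    P ∈ associatedPrimes (MvPolynomial σ K) (MvPolynomial σ K ⧸ J) ↔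
      ∃ T : Set σ, P = Ideal.span (X '' T) ∧ ∃ u, (∀ i ∈ T, u + Finsupp.single i 1 ∈ S) ∧
        ∀ v : σ →₀ ℕ, (∀ i ∈ T, v i = 0) → u + v ∉ S := by
  classical
  rw [AssociatedPrimes.mem_iff, isAssociatedPrime_iff]
  have hcolon : ∀ f r : MvPolynomial σ K,
      r ∈ (⊥ : Submodule (MvPolynomial σ K) (MvPolynomial σ K ⧸ J)).colon
        {Ideal.Quotient.mk J f} ↔ r * f ∈ J := by
    intro f r
    rw [Submodule.mem_colon_singleton, Submodule.mem_bot, ← Ideal.Quotient.eq_zero_iff_mem]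
    rfl
  constructor
  · rintro ⟨hP, x, hx⟩
    obtain ⟨f, rfl⟩ := Ideal.Quotient.mk_surjective x
    have hf : ∀ r, r ∈ P ↔ r * f ∈ J := fun r => by rw [hx, hcolon]
    have hspan := eq_span_X_of_colon mo hJ hP f hf
    refine ⟨_, hspan, ?_⟩
    by_contra! hcon
    have hX : ∀ u ∈ f.support, ∀ i, (X i : MvPolynomial σ K) ∈ P → u + Finsupp.single i 1 ∈ S := by
      intro u hu i hi
      refine (hJ _).1 ((hf _).1 hi) _ ?_
      rw [mem_support_iff, add_comm, coeff_X_mul]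
      exact mem_support_iff.1 hu
    choose! v hv0 hvS using fun u hu => hcon u (hX u hu)
    have hV : monomial (∑ u ∈ f.support, v u) (1 : K) ∈ P := by
      rw [hf, hJ]
      intro w hw
      obtain ⟨a, ha, u, hu, rfl⟩ := Finset.mem_add.1 (support_mul _ _ hw)
      rw [Finset.mem_singleton.1 (support_monomial_subset ha), add_comm]
      exact hS (add_le_add_right (Finset.single_le_sum (fun _ _ => zero_le) hu) u) (hvS u hu)
    rw [hspan, mem_span_X_image_monomial] at hV
    obtain ⟨i, hi, h⟩ := hV
    rw [Finsupp.finsetSum_apply] at h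
    exact h (Finset.sum_eq_zero fun u hu => hv0 u hu i hi)
  · rintro ⟨T, rfl, u, hu, hv⟩
    refine ⟨isPrime_span_X_image T, Ideal.Quotient.mk J (monomial u 1), ?_⟩
    ext r
    rw [hcolon, hJ, mem_ideal_span_X_image]
    constructor
    · intro h w hw
      obtain ⟨a, ha, b, hb, rfl⟩ := Finset.mem_add.1 (support_mul _ _ hw)
      rw [Finset.mem_singleton.1 (support_monomial_subset hb)]
      obtain ⟨i, hi, hai⟩ := h a ha
      refine hS ?_ (hu i hi)
      rw [add_comm]
      gcongr
      exact Finsupp.single_le_iff.2 (Nat.one_le_iff_ne_zero.2 hai)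
    · intro h w hw
      by_contra! hw0
      refine hv w hw0 ?_
      rw [add_comm]
      refine h _ ?_
      rw [mem_support_iff, coeff_mul_monomial, mul_one]
      exact mem_support_iff.1 hw

end MonomialIdeal

section Path

/-- Exponents of a monomial as a function on `ℕ`, listing the vertices of the path backwards. -/
def revExp {m : ℕ} (u : Fin (m + 2) →₀ ℕ) : ℕ → ℕ :=
  fun j => if h : j < m + 2 then u (Fin.rev ⟨j, h⟩) else 0

/-- The monomial whose backwards exponents are the first `m + 2` values of `w`. -/
def ofRevExp (m : ℕ) (w : ℕ → ℕ) : Fin (m + 2) →₀ ℕ :=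
  Finsupp.equivFunOnFinite.symm fun i => w (Fin.rev i)

variable {m : ℕ}

lemma revExp_add (u v : Fin (m + 2) →₀ ℕ) : revExp (u + v) = revExp u + revExp v := by
  ext j
  simp only [revExp, Pi.add_apply, Finsupp.add_apply]
  split_ifs <;> rfl

lemma revExp_single (i : Fin (m + 2)) (k : ℕ) :
    revExp (Finsupp.single i k) = Pi.single (i.rev : ℕ) k := by
  ext j
  simp only [revExp, Pi.single_apply, Finsupp.single_apply, Fin.ext_iff, Fin.val_rev]
  split_ifs <;> omega

lemma revExp_apply_rev (u : Fin (m + 2) →₀ ℕ) (i : Fin (m + 2)) : revExp u (i.rev : ℕ) = u i := by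
  rw [revExp, dif_pos i.rev.2, Fin.eta, Fin.rev_rev]

lemma revExp_injective : Function.Injective (revExp (m := m)) := by
  intro u v h
  ext i
  rw [← revExp_apply_rev, h, revExp_apply_rev]

lemma revExp_mono {u v : Fin (m + 2) →₀ ℕ} (h : u ≤ v) : revExp u ≤ revExp v := by
  intro j
  simp only [revExp]
  split_ifs
  · exact h _
  · rfl

lemma revExp_ofRevExp {w : ℕ → ℕ} {j : ℕ} (hj : j ≤ m + 1) : revExp (ofRevExp m w) j = w j := by
  rw [revExp, dif_pos (by omega)]
  simp [ofRevExp, Nat.sub_sub_self hj]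

lemma revExp_ofRevExp_of_forall {w : ℕ → ℕ} (h : ∀ j, m + 1 < j → w j = 0) :
    revExp (ofRevExp m w) = w := by
  ext j
  rcases le_or_gt j (m + 1) with hj | hj
  · exact revExp_ofRevExp hj
  · rw [h j hj, revExp, dif_neg (by omega)]

lemma revExp_edge {a b : Fin (m + 2)} (h : (a : ℕ) + 1 = b) :
    revExp (pathWeight (m + 2) a b • (Finsupp.single a 1 + Finsupp.single b 1)) =
      edgeVec (b.rev : ℕ) := by
  have ha : (a.rev : ℕ) = b.rev + 1 := by simp only [Fin.val_rev]; omega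
  have hb : (b.rev : ℕ) = 0 ↔ (b : ℕ) = m + 1 := by simp only [Fin.val_rev]; omega
  have ha' : (a : ℕ) ≠ m + 1 := by omega
  rw [smul_add, Finsupp.smul_single, Finsupp.smul_single, revExp_add, revExp_single, revExp_single,
    ha, edgeVec, add_comm]
  by_cases h0 : (b : ℕ) = m + 1
  · rw [if_pos (hb.2 h0), hb.2 h0]
    simp [pathWeight, h0]
  · rw [if_neg (mt hb.1 h0)]
    simp [pathWeight, h0, ha']

variable {K : Type*} [Field K]

lemma X_mul_X_pow (a b : Fin (m + 2)) (k : ℕ) :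
    (X a * X b : MvPolynomial (Fin (m + 2)) K) ^ k =
      monomial (k • (Finsupp.single a 1 + Finsupp.single b 1)) 1 := by
  rw [X, X, monomial_mul, monomial_pow]
  simp

lemma pathWeight_comm (n : ℕ) (a b : Fin n) : pathWeight n a b = pathWeight n b a := by
  simp only [pathWeight, or_comm]

lemma weightedEdgeIdeal_path_eq :
    weightedEdgeIdeal (m + 2) K (pathGraphN (m + 2)) (pathWeight (m + 2)) =
      Ideal.span ((fun s => monomial s (1 : K)) '' {e | ∃ i ≤ m, revExp e = edgeVec i}) := by
  rw [weightedEdgeIdeal]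
  congr 1
  ext f
  constructor
  · rintro ⟨a, b, hab, rfl⟩
    have key : ∀ a b : Fin (m + 2), (a : ℕ) + 1 = b →
        (X a * X b : MvPolynomial (Fin (m + 2)) K) ^ pathWeight (m + 2) a b ∈
        (fun s => monomial s (1 : K)) '' {e | ∃ i ≤ m, revExp e = edgeVec i} := fun a b h =>
      ⟨_, ⟨_, by simp only [Fin.val_rev]; omega, revExp_edge h⟩, (X_mul_X_pow a b _).symm⟩
    rw [pathGraphN, SimpleGraph.fromRel_adj] at hab
    rcases hab.2 with h | h
    · exact key a b h
    · rw [mul_comm, pathWeight_comm]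
      exact key b a h
  · rintro ⟨e, ⟨i, hi, he⟩, rfl⟩
    have h : ((Fin.rev ⟨i + 1, by omega⟩ : Fin (m + 2)) : ℕ) + 1 =
        (Fin.rev ⟨i, by omega⟩ : Fin (m + 2)) := by
      simp only [Fin.val_rev]; omega
    refine ⟨Fin.rev ⟨i + 1, by omega⟩, Fin.rev ⟨i, by omega⟩, ?_, ?_⟩
    · rw [pathGraphN, SimpleGraph.fromRel_adj]
      exact ⟨fun h' => by simp [h'] at h, Or.inl h⟩
    · rw [X_mul_X_pow]
      congr 2
      apply revExp_injective
      rw [revExp_edge h, he, Fin.rev_rev]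

lemma weightedEdgeIdeal_path_pow_eq (t : ℕ) :
    weightedEdgeIdeal (m + 2) K (pathGraphN (m + 2)) (pathWeight (m + 2)) ^ t =
      Ideal.span ((fun s => monomial s (1 : K)) '' {u | t ≤ edgeOrder m (revExp u)}) := by
  induction t with
  | zero =>
    rw [pow_zero, Ideal.one_eq_top, eq_comm, Ideal.eq_top_iff_one]
    exact Ideal.subset_span ⟨0, by simp⟩
  | succ t ih =>
    rw [pow_succ, ih, weightedEdgeIdeal_path_eq, Ideal.span_mul_span']
    congr 1
    ext f
    simp only [Set.mem_mul, Set.mem_image, Set.mem_ofPred_eq]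
    constructor
    · rintro ⟨_, ⟨u, hu, rfl⟩, _, ⟨e, ⟨i, hi, he⟩, rfl⟩, rfl⟩
      refine ⟨u + e, ?_, by simp [monomial_mul]⟩
      rw [revExp_add, he]
      exact hu.trans_lt (lt_edgeOrder_add_edgeVec hi _)
    · rintro ⟨u, hu, rfl⟩
      obtain ⟨i, hi, w, hw, ht⟩ := exists_edgeVec_le hu
      have h0 : ∀ j, m + 1 < j → w j + edgeVec i j = 0 := fun j hj => by
        rw [← Pi.add_apply, ← hw, revExp, dif_neg (by omega)]
      have h1 : revExp (ofRevExp m w) = w :=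
        revExp_ofRevExp_of_forall fun j hj => (Nat.add_eq_zero_iff.1 (h0 j hj)).1
      have h2 : revExp (ofRevExp m (edgeVec i)) = edgeVec i :=
        revExp_ofRevExp_of_forall fun j hj => (Nat.add_eq_zero_iff.1 (h0 j hj)).2
      refine ⟨_, ⟨ofRevExp m w, by rwa [h1], rfl⟩, _, ⟨_, ⟨i, hi, h2⟩, rfl⟩, ?_⟩
      rw [monomial_mul, one_mul]
      congr 2
      apply revExp_injective
      rw [revExp_add, h1, h2, hw]

/-- The vertices of the path, listed backwards, which lie in `T`. -/
def revMem (T : Set (Fin (m + 2))) (j : ℕ) : Prop :=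
  ∃ h : j < m + 2, Fin.rev ⟨j, h⟩ ∈ T

lemma revMem_rev {T : Set (Fin (m + 2))} {i : Fin (m + 2)} (hi : i ∈ T) :
    revMem T (i.rev : ℕ) :=
  ⟨i.rev.2, by rwa [Fin.eta, Fin.rev_rev]⟩

theorem mem_associatedPrimes_path_pow_iff {P : Ideal (MvPolynomial (Fin (m + 2)) K)} {t : ℕ} :
    P ∈ associatedPrimes (MvPolynomial (Fin (m + 2)) K) (MvPolynomial (Fin (m + 2)) K ⧸
        weightedEdgeIdeal (m + 2) K (pathGraphN (m + 2)) (pathWeight (m + 2)) ^ t) ↔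
      ∃ T : Set (Fin (m + 2)), P = Ideal.span (X '' T) ∧ ∃ u, IsWitness m (revMem T) t u := by
  have hS : IsUpperSet {u : Fin (m + 2) →₀ ℕ | t ≤ edgeOrder m (revExp u)} :=
    fun u v huv hu => le_trans hu (edgeOrder_mono (revExp_mono huv))
  rw [mem_associatedPrimes_iff_of_monomial (MonomialOrder.lex (σ := Fin (m + 2))) hS]
  · refine exists_congr fun T => and_congr_right fun _ => ⟨?_, ?_⟩
    · rintro ⟨u, h1, h2⟩
      refine ⟨revExp u, fun i hi => ?_, fun v hv => ?_⟩
      · rintro ⟨h, hT⟩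
        have := h1 _ hT
        simpa only [Set.mem_ofPred_eq, revExp_add, revExp_single, Fin.rev_rev] using this
      · have := h2 (ofRevExp m v) fun i hi => by simpa [ofRevExp] using hv _ (revMem_rev hi)
        rw [Set.mem_ofPred_eq, not_le, revExp_add] at this
        rwa [edgeOrder_congr (w := revExp u + v) fun j hj => by
          rw [Pi.add_apply, Pi.add_apply, revExp_ofRevExp hj]] at this
    · rintro ⟨w, h⟩
      replace h := h.congr (w := revExp (ofRevExp m w)) fun i hi => (revExp_ofRevExp hi).symm
      refine ⟨ofRevExp m w, fun i hi => ?_, fun v hv => ?_⟩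
      · rw [Set.mem_ofPred_eq, revExp_add, revExp_single]
        exact h.le_order _ (by simp only [Fin.val_rev]; omega) (revMem_rev hi)
      · rw [Set.mem_ofPred_eq, not_le, revExp_add]
        refine h.order_lt _ ?_
        rintro i ⟨hi, hT⟩
        rw [revExp, dif_pos hi, hv _ hT]
  · intro p
    rw [weightedEdgeIdeal_path_pow_eq, mem_ideal_span_monomial_image]
    exact forall₂_congr fun u _ => ⟨fun ⟨s, hs, hsu⟩ => hS hsu hs, fun h => ⟨u, h, le_rfl⟩⟩

lemma associatedPrimes_path_pow_eq {t : ℕ} (hm : 1 ≤ m) (ht : m ≤ t) :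
    associatedPrimes (MvPolynomial (Fin (m + 2)) K) (MvPolynomial (Fin (m + 2)) K ⧸
        weightedEdgeIdeal (m + 2) K (pathGraphN (m + 2)) (pathWeight (m + 2)) ^ t) =
      associatedPrimes (MvPolynomial (Fin (m + 2)) K) (MvPolynomial (Fin (m + 2)) K ⧸
        weightedEdgeIdeal (m + 2) K (pathGraphN (m + 2)) (pathWeight (m + 2)) ^ m) := by
  induction t, ht using Nat.le_induction with
  | base => rfl
  | succ t ht ih =>
    rw [← ih]
    ext P
    rw [mem_associatedPrimes_path_pow_iff, mem_associatedPrimes_path_pow_iff]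
    refine exists_congr fun T => and_congr_right fun _ => ⟨?_, ?_⟩
    · rintro ⟨u, hu⟩
      exact hu.exists_of_succ (hm.trans ht) ht
    · rintro ⟨u, hu⟩
      exact ⟨_, IsWitness.add_edgeVec_iff.2 hu⟩

lemma span_X_mem_associatedPrimes_path_pow_iff {t : ℕ} (hm : 1 ≤ m) :
    Ideal.span ((fun i => (X i : MvPolynomial (Fin (m + 2)) K)) ''
        {i : Fin (m + 2) | (i : ℕ) < m + 1}) ∈
      associatedPrimes (MvPolynomial (Fin (m + 2)) K) (MvPolynomial (Fin (m + 2)) K ⧸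
        weightedEdgeIdeal (m + 2) K (pathGraphN (m + 2)) (pathWeight (m + 2)) ^ t) ↔ m ≤ t := by
  rw [mem_associatedPrimes_path_pow_iff]
  constructor
  · rintro ⟨T, hT, u, hu⟩
    refine hu.le_of_forall_mem fun i h1 h2 => ⟨by omega, ?_⟩
    rw [← X_mem_span_X_image (K := K), ← hT, X_mem_span_X_image]
    simp only [Set.mem_ofPred_eq, Fin.val_rev]
    omega
  · intro ht
    refine ⟨_, rfl, IsWitness.exists_of_forall_mem hm (fun i h1 h2 => ⟨by omega, ?_⟩) ?_ ht⟩
    · simp only [Set.mem_ofPred_eq, Fin.val_rev]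
      omega
    · rintro ⟨h, h'⟩
      simp at h'

end Path


/-- Example 2.15: for the weighted path `G_ω` on `n ≥ 4` vertices with
weights `ω(x_i x_{i+1}) = 1` for `i ∈ [n-2]` and `ω(x_{n-1} x_n) = 2`, one has
`astab(I(G_ω)) = n - 2`; moreover `(x_1, …, x_{n-1}) ∈ Ass(I(G_ω)^t)` iff `t ≥ n - 2`. -/
theorem path_example (n : ℕ) (hn : 4 ≤ n) (K : Type*) [Field K] :
    astab (weightedEdgeIdeal n K (pathGraphN n) (pathWeight n)) = n - 2 ∧
    ∀ t : ℕ, 1 ≤ t →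
      (Ideal.span ((fun i => (X i : MvPolynomial (Fin n) K)) ''
            {i : Fin n | (i : ℕ) < n - 1}) ∈
          associatedPrimes (MvPolynomial (Fin n) K)
            (MvPolynomial (Fin n) K ⧸
              (weightedEdgeIdeal n K (pathGraphN n) (pathWeight n) ^ t))
        ↔ n - 2 ≤ t) := by
  obtain ⟨m, rfl⟩ := Nat.exists_eq_add_of_le' (show 2 ≤ n by omega)
  rw [show m + 2 - 2 = m by omega]
  refine ⟨le_antisymm (Nat.sInf_le ⟨by omega, fun t ht => ?_⟩) ?_, fun t _ => ?_⟩
  · exact associatedPrimes_path_pow_eq (by omega) ht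
  · refine le_csInf ⟨m, by omega, fun t ht => associatedPrimes_path_pow_eq (by omega) ht⟩ ?_
    rintro s ⟨-, hs⟩
    have h := (span_X_mem_associatedPrimes_path_pow_iff (K := K) (by omega)).2 (le_max_right s m)
    rw [hs _ (le_max_left s m)] at h
    exact (span_X_mem_associatedPrimes_path_pow_iff (by omega)).1 h
  · exact span_X_mem_associatedPrimes_path_pow_iff (by omega)
end
end
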